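/- With Ψ as above, Ψ commutes with the last face map: Ψ(dⁿ⁺¹φ)(x⁰,…,xⁿ⁺¹) = Ψφ(xⁿ⁺¹x⁰, x¹, …, xⁿ), where dⁿ⁺¹φ(h, a⁰,…,aⁿ⁺¹) = φ(h₍₂₎, S⁻¹(h₍₁₎)(aⁿ⁺¹)a⁰, a¹, …, aⁿ). -/

import Mathlib

noncomputable section

open TensorProduct

variable {H A : Type} [Ring H] [HopfAlgebra ℂ H] [Ring A] [Algebra ℂ A]

/-- `sweedler N Δ₁ Δ₂ k g F` is the Sweedler sum `Σ F (g₍₁₎, …, g₍ₖ₊₁₎)`, computed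
from a chosen finite representation `comul g = Σ_{i < N g} Δ₁ g i ⊗ Δ₂ g i` of the
comultiplication. -/
def sweedler (N : H → ℕ) (Δ₁ Δ₂ : H → ℕ → H) :
    (k : ℕ) → H → ((Fin (k+1) → H) → ℂ) → ℂ
  | 0, g, F => F ![g]
  | k+1, g, F => ∑ i ∈ Finset.range (N g),
      sweedler N Δ₁ Δ₂ k (Δ₂ g i) (fun v => F (Fin.cons (Δ₁ g i) v))

/-- The multiplication of the crossed product `A ⋊ H`, as a linear map on
`(A ⊗ H) ⊗ (A ⊗ H)`; on pure tensors it is `(a ⊗ h)(b ⊗ g) = a h₍₁₎(b) ⊗ h₍₂₎ g`. -/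
def cpMul (ρ : H →ₗ[ℂ] A →ₗ[ℂ] A) :
    (A ⊗[ℂ] H) ⊗[ℂ] (A ⊗[ℂ] H) →ₗ[ℂ] A ⊗[ℂ] H :=
  (LinearMap.rTensor H (LinearMap.mul' ℂ A)) ∘ₗ
  (TensorProduct.assoc ℂ A A H).symm.toLinearMap ∘ₗ
  (LinearMap.lTensor A (TensorProduct.map (TensorProduct.lift ρ) (LinearMap.mul' ℂ H))) ∘ₗ
  (LinearMap.lTensor A (TensorProduct.tensorTensorTensorComm ℂ H H A H).toLinearMap) ∘ₗ
  (LinearMap.lTensor A (LinearMap.rTensor (A ⊗[ℂ] H) (Coalgebra.comul (R := ℂ)))) ∘ₗ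
  (TensorProduct.assoc ℂ A H (A ⊗[ℂ] H)).toLinearMap

/-- The tuple obtained from `x` by replacing the pair `(xʲ, xʲ⁺¹)` by the single
entry `y` (used with `y = xʲ xʲ⁺¹` for the `j`-th face map). -/
def faceTup {α : Type} {n : ℕ} (j : Fin (n+1)) (y : α) (x : Fin (n+2) → α) :
    Fin (n+1) → α :=
  fun k => if (k : ℕ) < (j : ℕ) then x k.castSucc else if k = j then y else x k.succ

/-- The `i`-th term of the product `(p.1 ⊗ p.2)(q.1 ⊗ q.2)` in `A ⋊ H`, for the chosen
representation of the comultiplication: `p.1 · (Δ₁ p.2 i)(q.1) ⊗ (Δ₂ p.2 i) q.2`. -/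
def cpPairTerm (Δ₁ Δ₂ : H → ℕ → H) (ρ : H →ₗ[ℂ] A →ₗ[ℂ] A) (p q : A × H) (i : ℕ) :
    A × H :=
  (p.1 * ρ (Δ₁ p.2 i) q.1, Δ₂ p.2 i * q.2)

/-- The Hochschild coboundary of a cochain on the crossed product `A ⋊ H`. -/
def cpb (ρ : H →ₗ[ℂ] A →ₗ[ℂ] A) {n : ℕ} (f : (Fin (n+1) → A ⊗[ℂ] H) → ℂ) :
    (Fin (n+2) → A ⊗[ℂ] H) → ℂ := fun x =>
  (∑ j : Fin (n+1), (-1 : ℂ) ^ (j : ℕ) *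
      f (faceTup j (cpMul ρ (x j.castSucc ⊗ₜ[ℂ] x j.succ)) x))
  + (-1 : ℂ) ^ (n+1) *
      f (fun k => if (k : ℕ) = 0 then cpMul ρ (x (Fin.last (n+1)) ⊗ₜ[ℂ] x 0)
                  else x k.castSucc)

/-- `f` vanishes whenever some argument in position `≥ 1` lies in the subalgebra
`1 ⊗ H` of `A ⋊ H`. -/
def HConstVanish {m : ℕ} (f : (Fin m → A ⊗[ℂ] H) → ℂ) : Prop :=
  ∀ x : Fin m → A ⊗[ℂ] H,
    (∃ j : Fin m, 0 < (j : ℕ) ∧ ∃ h : H, x j = (1 : A) ⊗ₜ[ℂ] h) → f x = 0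

/-- An `H`-constant cochain on `A ⋊ H`: both `f` and `bf` vanish whenever some
argument in position `≥ 1` lies in `1 ⊗ H`. -/
def IsHConstant (ρ : H →ₗ[ℂ] A →ₗ[ℂ] A) {n : ℕ}
    (f : MultilinearMap ℂ (fun _ : Fin (n+1) => A ⊗[ℂ] H) ℂ) : Prop :=
  HConstVanish ⇑f ∧ HConstVanish (cpb ρ ⇑f)

/-- Auxiliary recursion for `Ψ`: processes the pairs `x¹, …, xᵏ`, keeping an
accumulated Hopf algebra element `g`; at each step `Δg = g₍₁₎ ⊗ g₍₂₎` is split, the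
current slot becomes `g₍₁₎(aʲ)` and the accumulator becomes `g₍₂₎ hʲ`. -/
def psiAux (N : H → ℕ) (Δ₁ Δ₂ : H → ℕ → H) (ρ : H →ₗ[ℂ] A →ₗ[ℂ] A) :
    (k : ℕ) → H → (Fin k → A × H) → (H → (Fin k → A) → ℂ) → ℂ
  | 0, g, _, F => F g ![]
  | k+1, g, x, F => ∑ i ∈ Finset.range (N g),
      psiAux N Δ₁ Δ₂ ρ k (Δ₂ g i * (x 0).2) (fun j => x j.succ)
        (fun h v => F h (Fin.cons (ρ (Δ₁ g i) (x 0).1) v))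

/-- The value of `Ψφ` on the elementary tensors `a⁰ ⊗ h⁰, …, aⁿ ⊗ hⁿ`:
`Ψ(φ)(a⁰⊗h⁰, …, aⁿ⊗hⁿ) = φ(h⁰₍ₙ₊₁₎ ⋯ h^{n-1}₍₂₎ hⁿ, a⁰, h⁰₍₁₎(a¹), …,
h⁰₍ₙ₎⋯h^{n-1}₍₁₎(aⁿ))`. -/
def psiV (N : H → ℕ) (Δ₁ Δ₂ : H → ℕ → H) (ρ : H →ₗ[ℂ] A →ₗ[ℂ] A) {n : ℕ}
    (φf : H → (Fin (n+1) → A) → ℂ) (x : Fin (n+1) → A × H) : ℂ :=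
  psiAux N Δ₁ Δ₂ ρ n ((x 0).2) (fun j => x j.succ)
    (fun h v => φf h (Fin.cons (x 0).1 v))

/-- The equivariance condition `φ(S(g₍₂₎) h g₍₁₎, a⁰, …, aⁿ) =
φ(h, g₍₁₎(a⁰), …, g₍ₙ₊₁₎(aⁿ))` for a cochain `φ : H ⊗ A^{⊗(n+1)} → ℂ`. -/
def IsEquivariant (N : H → ℕ) (Δ₁ Δ₂ : H → ℕ → H) (ρ : H →ₗ[ℂ] A →ₗ[ℂ] A) {n : ℕ}
    (φf : H → (Fin (n+1) → A) → ℂ) : Prop :=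
  ∀ (g h : H) (a : Fin (n+1) → A),
    sweedler N Δ₁ Δ₂ 1 g
      (fun ℓ => φf (HopfAlgebra.antipode (R := ℂ) (ℓ 1) * h * ℓ 0) a)
      = sweedler N Δ₁ Δ₂ n g (fun ℓ => φf h (fun j => ρ (ℓ j) (a j)))

/-- The cyclic operator on equivariant cochains:
`t φ(h, a⁰, …, aⁿ) = φ(h₍₂₎, S⁻¹(h₍₁₎)(aⁿ), a⁰, …, aⁿ⁻¹)`. -/
def cycOpEq (N : H → ℕ) (Δ₁ Δ₂ : H → ℕ → H) (ρ : H →ₗ[ℂ] A →ₗ[ℂ] A)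
    (Sinv : H →ₗ[ℂ] H) {n : ℕ} (φf : H → (Fin (n+1) → A) → ℂ) :
    H → (Fin (n+1) → A) → ℂ := fun h a =>
  sweedler N Δ₁ Δ₂ 1 h (fun ℓ =>
    φf (ℓ 1) (Fin.cons (ρ (Sinv (ℓ 0)) (a (Fin.last n))) (fun j : Fin n => a j.castSucc)))

/-- The map `Φ`: `(Φf)(h, a⁰, …, aⁿ) = f(a⁰ ⊗ 1, …, aⁿ⁻¹ ⊗ 1, aⁿ ⊗ h)`. -/
def phiV {n : ℕ} (f : MultilinearMap ℂ (fun _ : Fin (n+1) => A ⊗[ℂ] H) ℂ) :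
    H → (Fin (n+1) → A) → ℂ := fun h a =>
  f (fun i => if i = Fin.last n then a i ⊗ₜ[ℂ] h else a i ⊗ₜ[ℂ] (1 : H))


/-- The chosen sums represent the comultiplication. -/
def HRep (N : H → ℕ) (Δ₁ Δ₂ : H → ℕ → H) : Prop :=
  ∀ g : H, (Coalgebra.comul (R := ℂ) g : H ⊗[ℂ] H) =
      ∑ i ∈ Finset.range (N g), Δ₁ g i ⊗ₜ[ℂ] Δ₂ g i

/-- The representation as a Mathlib `Coalgebra.Repr`. -/
def HRep.repr {N : H → ℕ} {Δ₁ Δ₂ : H → ℕ → H} (hr : HRep N Δ₁ Δ₂) (g : H) :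
    Coalgebra.Repr ℂ g ℕ where
  index := Finset.range (N g)
  left := Δ₁ g
  right := Δ₂ g
  eq := (hr g).symm

/-- Bilinear functions as bundled maps. -/
def mkB {M : Type} [AddCommGroup M] [Module ℂ M] (f : H → H → M)
    (h1 : ∀ y, IsLinearMap ℂ (fun x => f x y)) (h2 : ∀ x, IsLinearMap ℂ (fun y => f x y)) :
    H →ₗ[ℂ] H →ₗ[ℂ] M :=
  LinearMap.mk₂ ℂ f (fun a b y => (h1 y).map_add a b) (fun c a y => (h1 y).map_smul c a)
    (fun x a b => (h2 x).map_add a b) (fun c x a => (h2 x).map_smul c a)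

theorem sum_eq_lift {M : Type} [AddCommGroup M] [Module ℂ M]
    {N : H → ℕ} {Δ₁ Δ₂ : H → ℕ → H} (hr : HRep N Δ₁ Δ₂) (f : H → H → M)
    (h1 : ∀ y, IsLinearMap ℂ (fun x => f x y)) (h2 : ∀ x, IsLinearMap ℂ (fun y => f x y))
    (g : H) :
    ∑ i ∈ Finset.range (N g), f (Δ₁ g i) (Δ₂ g i) =
      TensorProduct.lift (mkB f h1 h2) (Coalgebra.comul (R := ℂ) g) := by
  rw [hr g]; simp [mkB]

theorem sum_lin {M : Type} [AddCommGroup M] [Module ℂ M]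
    {N : H → ℕ} {Δ₁ Δ₂ : H → ℕ → H} (hr : HRep N Δ₁ Δ₂) (f : H → H → M)
    (h1 : ∀ y, IsLinearMap ℂ (fun x => f x y)) (h2 : ∀ x, IsLinearMap ℂ (fun y => f x y)) :
    IsLinearMap ℂ (fun g => ∑ i ∈ Finset.range (N g), f (Δ₁ g i) (Δ₂ g i)) := by
  constructor
  · intro a b; simp only [sum_eq_lift hr f h1 h2, map_add]
  · intro c a; simp only [sum_eq_lift hr f h1 h2, map_smul]

theorem sum_eps_left {M : Type} [AddCommGroup M] [Module ℂ M]
    {N : H → ℕ} {Δ₁ Δ₂ : H → ℕ → H} (hr : HRep N Δ₁ Δ₂) (T : H → M)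
    (hT : IsLinearMap ℂ T) (g : H) :
    ∑ i ∈ Finset.range (N g), Coalgebra.counit (R := ℂ) (Δ₁ g i) • T (Δ₂ g i) = T g := by
  have := congrArg (hT.mk' T) (Coalgebra.sum_counit_smul (R := ℂ) (hr.repr g))
  simpa [HRep.repr, map_sum] using this

theorem sum_eps_right {M : Type} [AddCommGroup M] [Module ℂ M]
    {N : H → ℕ} {Δ₁ Δ₂ : H → ℕ → H} (hr : HRep N Δ₁ Δ₂) (T : H → M)
    (hT : IsLinearMap ℂ T) (g : H) :
    ∑ i ∈ Finset.range (N g), Coalgebra.counit (R := ℂ) (Δ₂ g i) • T (Δ₁ g i) = T g := by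
  have h2 := congrArg (TensorProduct.lift ((LinearMap.lsmul ℂ M).flip ∘ₗ hT.mk' T))
    (Coalgebra.sum_tmul_counit_eq (R := ℂ) (hr.repr g))
  simpa [HRep.repr, map_sum] using h2

theorem sum_coassoc {M : Type} [AddCommGroup M] [Module ℂ M]
    {N : H → ℕ} {Δ₁ Δ₂ : H → ℕ → H} (hr : HRep N Δ₁ Δ₂) (f : H → H → H → M)
    (h1 : ∀ y z, IsLinearMap ℂ (fun x => f x y z))
    (h2 : ∀ x z, IsLinearMap ℂ (fun y => f x y z))
    (h3 : ∀ x y, IsLinearMap ℂ (fun z => f x y z)) (g : H) :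
    ∑ i ∈ Finset.range (N g), ∑ j ∈ Finset.range (N (Δ₁ g i)),
        f (Δ₁ (Δ₁ g i) j) (Δ₂ (Δ₁ g i) j) (Δ₂ g i) =
    ∑ i ∈ Finset.range (N g), ∑ j ∈ Finset.range (N (Δ₂ g i)),
        f (Δ₁ g i) (Δ₁ (Δ₂ g i) j) (Δ₂ (Δ₂ g i) j) := by
  let T : H →ₗ[ℂ] H →ₗ[ℂ] H →ₗ[ℂ] M := LinearMap.mk₂ ℂ
    (fun x y => (h3 x y).mk' _)
    (fun a b y => by ext z; exact (h1 y z).map_add a b)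
    (fun c a y => by ext z; exact (h1 y z).map_smul c a)
    (fun x a b => by ext z; exact (h2 x z).map_add a b)
    (fun c x a => by ext z; exact (h2 x z).map_smul c a)
  have h := Coalgebra.sum_tmul_tmul_eq (R := ℂ) (hr.repr g) (fun i => hr.repr (Δ₁ g i))
    (fun i => hr.repr (Δ₂ g i))
  have := congrArg (TensorProduct.lift (TensorProduct.lift T) ∘ₗ
    (TensorProduct.assoc ℂ H H H).symm.toLinearMap) h
  simpa [HRep.repr, map_sum, T] using this

theorem sum_comul_mul {M : Type} [AddCommGroup M] [Module ℂ M]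
    {N : H → ℕ} {Δ₁ Δ₂ : H → ℕ → H} (hr : HRep N Δ₁ Δ₂) (f : H → H → M)
    (h1 : ∀ y, IsLinearMap ℂ (fun x => f x y)) (h2 : ∀ x, IsLinearMap ℂ (fun y => f x y))
    (g h : H) :
    ∑ i ∈ Finset.range (N (g * h)), f (Δ₁ (g * h) i) (Δ₂ (g * h) i) =
    ∑ i ∈ Finset.range (N g), ∑ j ∈ Finset.range (N h),
      f (Δ₁ g i * Δ₁ h j) (Δ₂ g i * Δ₂ h j) := by
  rw [sum_eq_lift hr f h1 h2, Bialgebra.comul_mul, hr g, hr h, Finset.sum_mul_sum]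
  simp [mkB]

/-- Currying the first algebra slot. -/
def cur {k : ℕ} (F : H →ₗ[ℂ] MultilinearMap ℂ (fun _ : Fin (k+1) => A) ℂ) (a : A) :
    H →ₗ[ℂ] MultilinearMap ℂ (fun _ : Fin k => A) ℂ where
  toFun h := (F h).curryLeft a
  map_add' x y := by ext v; simp
  map_smul' c x := by ext v; simp

theorem psiAux_sum {ι : Type} (s : Finset ι)
    (N : H → ℕ) (Δ₁ Δ₂ : H → ℕ → H) (ρ : H →ₗ[ℂ] A →ₗ[ℂ] A) (k : ℕ) (g : H)
    (x : Fin k → A × H) (F : ι → H → (Fin k → A) → ℂ) :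
    psiAux N Δ₁ Δ₂ ρ k g x (fun h v => ∑ i ∈ s, F i h v) =
      ∑ i ∈ s, psiAux N Δ₁ Δ₂ ρ k g x (F i) := by
  induction k generalizing g with
  | zero => rfl
  | succ k ih =>
    simp only [psiAux]
    rw [Finset.sum_comm]
    refine Finset.sum_congr rfl fun i _ => ?_
    rw [ih]

theorem psiAux_add (N : H → ℕ) (Δ₁ Δ₂ : H → ℕ → H) (ρ : H →ₗ[ℂ] A →ₗ[ℂ] A) (k : ℕ) (g : H)
    (x : Fin k → A × H) (F G : H → (Fin k → A) → ℂ) :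
    psiAux N Δ₁ Δ₂ ρ k g x (fun h v => F h v + G h v) =
      psiAux N Δ₁ Δ₂ ρ k g x F + psiAux N Δ₁ Δ₂ ρ k g x G := by
  induction k generalizing g with
  | zero => rfl
  | succ k ih =>
    simp only [psiAux]
    rw [← Finset.sum_add_distrib]
    refine Finset.sum_congr rfl fun i _ => ?_
    rw [ih]

theorem psiAux_smul (N : H → ℕ) (Δ₁ Δ₂ : H → ℕ → H) (ρ : H →ₗ[ℂ] A →ₗ[ℂ] A) (k : ℕ) (g : H)
    (x : Fin k → A × H) (c : ℂ) (F : H → (Fin k → A) → ℂ) :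
    psiAux N Δ₁ Δ₂ ρ k g x (fun h v => c * F h v) =
      c * psiAux N Δ₁ Δ₂ ρ k g x F := by
  induction k generalizing g with
  | zero => rfl
  | succ k ih =>
    simp only [psiAux]
    rw [Finset.mul_sum]
    refine Finset.sum_congr rfl fun i _ => ?_
    rw [ih]

theorem psiAux_lin_F {E : Type} [AddCommGroup E] [Module ℂ E]
    (N : H → ℕ) (Δ₁ Δ₂ : H → ℕ → H) (ρ : H →ₗ[ℂ] A →ₗ[ℂ] A) (k : ℕ)
    (g : H) (x : Fin k → A × H) (F : E → H → (Fin k → A) → ℂ)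
    (hF : ∀ h v, IsLinearMap ℂ (fun e => F e h v)) :
    IsLinearMap ℂ (fun e => psiAux N Δ₁ Δ₂ ρ k g x (F e)) := by
  constructor
  · intro a b
    rw [← psiAux_add]
    congr 1; funext h v; exact (hF h v).map_add a b
  · intro c a
    rw [smul_eq_mul, ← psiAux_smul]
    congr 1; funext h v; exact (hF h v).map_smul c a

theorem cons_lin {k : ℕ} (M : MultilinearMap ℂ (fun _ : Fin (k+1) => A) ℂ) (v : Fin k → A) :
    IsLinearMap ℂ (fun a : A => M (Fin.cons a v)) :=
  ⟨fun a b => M.cons_add v a b, fun c a => M.cons_smul v c a⟩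

theorem psiAux_lin_g {N : H → ℕ} {Δ₁ Δ₂ : H → ℕ → H} (hr : HRep N Δ₁ Δ₂)
    (ρ : H →ₗ[ℂ] A →ₗ[ℂ] A) (k : ℕ) (x : Fin k → A × H)
    (F : H →ₗ[ℂ] MultilinearMap ℂ (fun _ : Fin k => A) ℂ) :
    IsLinearMap ℂ (fun g => psiAux N Δ₁ Δ₂ ρ k g x (fun h v => F h v)) := by
  induction k with
  | zero => exact ⟨by intros; simp [psiAux], by intros; simp [psiAux]⟩
  | succ k ih =>
    simp only [psiAux]
    refine sum_lin hr (fun p q => psiAux N Δ₁ Δ₂ ρ k (q * (x 0).2) (fun j => x j.succ)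
        (fun h v => F h (Fin.cons (ρ p (x 0).1) v))) ?_ ?_
    · intro q
      refine psiAux_lin_F N Δ₁ Δ₂ ρ k _ _ _ ?_
      intro h v
      exact ((cons_lin (F h) v).mk' _ ∘ₗ ρ.flip (x 0).1).isLinear
    · intro p
      exact ((ih (fun j => x j.succ) (cur F (ρ p (x 0).1))).mk' _ ∘ₗ
        LinearMap.mulRight ℂ (x 0).2).isLinear

/-- Peeling off the last entry. -/
theorem psiAux_last (N : H → ℕ) (Δ₁ Δ₂ : H → ℕ → H) (ρ : H →ₗ[ℂ] A →ₗ[ℂ] A) (k : ℕ) (g : H)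
    (x : Fin (k+1) → A × H) (F : H → (Fin (k+1) → A) → ℂ) :
    psiAux N Δ₁ Δ₂ ρ (k+1) g x F =
      psiAux N Δ₁ Δ₂ ρ k g (fun j => x j.castSucc) (fun g v => ∑ i ∈ Finset.range (N g),
        F (Δ₂ g i * (x (Fin.last k)).2)
          (Fin.snoc (α := fun _ => A) v (ρ (Δ₁ g i) (x (Fin.last k)).1))) := by
  induction k generalizing g with
  | zero =>
    simp only [psiAux]
    refine Finset.sum_congr rfl fun i _ => ?_
    congr 1
    funext j
    fin_cases j
    rfl
  | succ k ih =>
    rw [psiAux, psiAux]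
    refine Finset.sum_congr rfl fun i _ => ?_
    rw [ih]
    simp only [Fin.cons_snoc_eq_snoc_cons]
    rfl

/-- Moving a left factor of the accumulator through. -/
theorem psiAux_mul {N : H → ℕ} {Δ₁ Δ₂ : H → ℕ → H} (hr : HRep N Δ₁ Δ₂)
    (ρ : H →ₗ[ℂ] A →ₗ[ℂ] A) (hρ_mul : ∀ g h : H, ρ (g * h) = ρ g ∘ₗ ρ h)
    (k : ℕ) (x : Fin k → A × H) (g h : H)
    (F : H →ₗ[ℂ] MultilinearMap ℂ (fun _ : Fin k => A) ℂ) :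
    psiAux N Δ₁ Δ₂ ρ k (h * g) x (fun h v => F h v) =
      psiAux N Δ₁ Δ₂ ρ k g x (fun g' v =>
        psiAux N Δ₁ Δ₂ ρ k h (fun j => (v j, 1)) (fun p w => F (p * g') w)) := by
  induction k generalizing g h with
  | zero => rfl
  | succ k ih =>
    rw [psiAux, psiAux]
    rw [sum_comul_mul hr (fun p q => psiAux N Δ₁ Δ₂ ρ k (q * (x 0).2) (fun j => x j.succ)
        (fun h v => F h (Fin.cons (ρ p (x 0).1) v)))]
    · rw [Finset.sum_comm]
      refine Finset.sum_congr rfl fun b _ => ?_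
      simp only [psiAux]
      rw [psiAux_sum]
      refine Finset.sum_congr rfl fun a _ => ?_
      rw [mul_assoc]
      have := ih (fun j => x j.succ) (Δ₂ g b * (x 0).2) (Δ₂ h a)
        (cur F (ρ (Δ₁ h a * Δ₁ g b) (x 0).1))
      refine Eq.trans this ?_
      simp only [hρ_mul, mul_one]
      rfl
    · intro q
      refine psiAux_lin_F N Δ₁ Δ₂ ρ k _ _ _ ?_
      intro h v
      exact ((cons_lin (F h) v).mk' _ ∘ₗ ρ.flip (x 0).1).isLinear
    · intro p
      exact ((psiAux_lin_g hr ρ k (fun j => x j.succ) (cur F (ρ p (x 0).1))).mk' _ ∘ₗ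
        LinearMap.mulRight ℂ (x 0).2).isLinear

/-- The cochain `h ↦ ε(h) M`. -/
def epsM {k : ℕ} (M : MultilinearMap ℂ (fun _ : Fin k => A) ℂ) :
    H →ₗ[ℂ] MultilinearMap ℂ (fun _ : Fin k => A) ℂ :=
  (Coalgebra.counit (R := ℂ) (A := H)).smulRight M

theorem sweedler_eq_psiAux {N : H → ℕ} {Δ₁ Δ₂ : H → ℕ → H} (hr : HRep N Δ₁ Δ₂)
    (ρ : H →ₗ[ℂ] A →ₗ[ℂ] A) (k : ℕ) (b : Fin (k+1) → A) (q : H)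
    (M : MultilinearMap ℂ (fun _ : Fin (k+1) => A) ℂ) :
    sweedler N Δ₁ Δ₂ k q (fun ℓ => M (fun j => ρ (ℓ j) (b j))) =
      psiAux N Δ₁ Δ₂ ρ (k+1) q (fun j => (b j, 1))
        (fun h v => Coalgebra.counit (R := ℂ) h * M v) := by
  induction k generalizing q with
  | zero =>
    simp only [psiAux, sweedler, mul_one]
    have := sum_eps_right hr (fun p => M (Fin.cons (ρ p (b 0)) ![]))
      ((cons_lin M _).mk' _ ∘ₗ ρ.flip (b 0)).isLinear q
    simp only [smul_eq_mul] at this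
    refine Eq.trans ?_ this.symm
    congr 1
    funext j
    fin_cases j
    rfl
  | succ k ih =>
    rw [psiAux, sweedler]
    refine Finset.sum_congr rfl fun i _ => ?_
    have := ih (fun j => b j.succ) (Δ₂ q i) (M.curryLeft (ρ (Δ₁ q i) (b 0)))
    rw [mul_one]
    refine Eq.trans ?_ this
    congr 1
    funext ℓ
    rw [MultilinearMap.curryLeft_apply]
    congr 1
    funext j
    refine Fin.cases ?_ (fun j => ?_) j <;> simp

/-- Splitting off the last Sweedler leg. -/
theorem psiAux_split {N : H → ℕ} {Δ₁ Δ₂ : H → ℕ → H} (hr : HRep N Δ₁ Δ₂)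
    (ρ : H →ₗ[ℂ] A →ₗ[ℂ] A) (k : ℕ) (b : Fin k → A) (h : H)
    (F : H →ₗ[ℂ] MultilinearMap ℂ (fun _ : Fin k => A) ℂ) :
    psiAux N Δ₁ Δ₂ ρ k h (fun j => (b j, 1)) (fun p v => F p v) =
      ∑ i ∈ Finset.range (N h), psiAux N Δ₁ Δ₂ ρ k (Δ₁ h i) (fun j => (b j, 1))
        (fun p v => Coalgebra.counit (R := ℂ) p * F (Δ₂ h i) v) := by
  induction k generalizing h with
  | zero =>
    simp only [psiAux]
    exact (sum_eps_left hr (fun p => F p ![])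
      ⟨by intros; simp, by intros; simp⟩ h).symm
  | succ k ih =>
    simp only [psiAux, mul_one]
    rw [sum_coassoc hr (fun p q r => psiAux N Δ₁ Δ₂ ρ k q (fun j => (b j.succ, 1))
      (fun h v => Coalgebra.counit (R := ℂ) h * F r (Fin.cons (ρ p (b 0)) v)))]
    · refine Finset.sum_congr rfl fun i _ => ?_
      exact ih (fun j => b j.succ) (Δ₂ h i) (cur F (ρ (Δ₁ h i) (b 0)))
    · intro q r
      refine psiAux_lin_F N Δ₁ Δ₂ ρ k _ _ _ ?_
      intro h v
      exact (Coalgebra.counit (R := ℂ) h •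
        ((cons_lin (F r) v).mk' _ ∘ₗ ρ.flip (b 0))).isLinear
    · intro p r
      exact psiAux_lin_g hr ρ k (fun j => (b j.succ, 1))
        (epsM ((F r).curryLeft (ρ p (b 0))))
    · intro p q
      refine psiAux_lin_F N Δ₁ Δ₂ ρ k _ _ _ ?_
      intro h v
      exact ⟨by intros; simp [mul_add], by intros; simp [mul_left_comm]⟩

theorem Sinv_mul (Sinv : H →ₗ[ℂ] H)
    (hSinv : ∀ h : H, Sinv (HopfAlgebra.antipode (R := ℂ) h) = h ∧
      HopfAlgebra.antipode (R := ℂ) (Sinv h) = h) (g h : H) :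
    Sinv (g * h) = Sinv h * Sinv g := by
  rw [← (hSinv (Sinv h * Sinv g)).1, HopfAlgebra.antipode_mul_antidistrib, (hSinv g).2,
    (hSinv h).2]

theorem sum_Sinv_mul {N : H → ℕ} {Δ₁ Δ₂ : H → ℕ → H} (hr : HRep N Δ₁ Δ₂) (Sinv : H →ₗ[ℂ] H)
    (hSinv : ∀ h : H, Sinv (HopfAlgebra.antipode (R := ℂ) h) = h ∧
      HopfAlgebra.antipode (R := ℂ) (Sinv h) = h) (g : H) :
    ∑ i ∈ Finset.range (N g), Sinv (Δ₂ g i) * Δ₁ g i = Coalgebra.counit (R := ℂ) g • 1 := by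
  rw [← (hSinv (∑ i ∈ Finset.range (N g), Sinv (Δ₂ g i) * Δ₁ g i)).1]
  have h := HopfAlgebra.sum_antipode_mul_eq_smul (R := ℂ) (hr.repr g)
  simp only [HRep.repr] at h
  have h1 : Sinv 1 = 1 := by
    have := (hSinv 1).1
    rwa [HopfAlgebra.antipode_one] at this
  simp only [map_sum, HopfAlgebra.antipode_mul_antidistrib, (hSinv _).2]
  rw [← map_sum, h, map_smul, h1]

theorem sum_mul_Sinv {N : H → ℕ} {Δ₁ Δ₂ : H → ℕ → H} (hr : HRep N Δ₁ Δ₂) (Sinv : H →ₗ[ℂ] H)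
    (hSinv : ∀ h : H, Sinv (HopfAlgebra.antipode (R := ℂ) h) = h ∧
      HopfAlgebra.antipode (R := ℂ) (Sinv h) = h) (g : H) :
    ∑ i ∈ Finset.range (N g), Δ₂ g i * Sinv (Δ₁ g i) = Coalgebra.counit (R := ℂ) g • 1 := by
  rw [← (hSinv (∑ i ∈ Finset.range (N g), Δ₂ g i * Sinv (Δ₁ g i))).1]
  have h := HopfAlgebra.sum_mul_antipode_eq_smul (R := ℂ) (hr.repr g)
  simp only [HRep.repr] at h
  have h1 : Sinv 1 = 1 := by
    have := (hSinv 1).1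
    rwa [HopfAlgebra.antipode_one] at this
  simp only [map_sum, HopfAlgebra.antipode_mul_antidistrib, (hSinv _).2]
  rw [← map_sum, h, map_smul, h1]

theorem lhs_point {N : H → ℕ} {Δ₁ Δ₂ : H → ℕ → H} (hr : HRep N Δ₁ Δ₂)
    (ρ : H →ₗ[ℂ] A →ₗ[ℂ] A) (hρ_one : ρ 1 = LinearMap.id)
    (hρ_mul : ∀ g h : H, ρ (g * h) = ρ g ∘ₗ ρ h)
    (Sinv : H →ₗ[ℂ] H)
    (hSinv : ∀ h : H, Sinv (HopfAlgebra.antipode (R := ℂ) h) = h ∧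
      HopfAlgebra.antipode (R := ℂ) (Sinv h) = h)
    (Θ : H →ₗ[ℂ] A →ₗ[ℂ] ℂ) (a a0 : A) (g h : H) :
    ∑ i ∈ Finset.range (N g), ∑ j ∈ Finset.range (N (Δ₂ g i * h)),
      Θ (Δ₂ (Δ₂ g i * h) j) (ρ (Sinv (Δ₁ (Δ₂ g i * h) j)) (ρ (Δ₁ g i) a) * a0) =
    ∑ m ∈ Finset.range (N h), Θ (g * Δ₂ h m) (ρ (Sinv (Δ₁ h m)) a * a0) := by
  have e1 : ∀ i, ∑ j ∈ Finset.range (N (Δ₂ g i * h)),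
      Θ (Δ₂ (Δ₂ g i * h) j) (ρ (Sinv (Δ₁ (Δ₂ g i * h) j)) (ρ (Δ₁ g i) a) * a0) =
      ∑ m ∈ Finset.range (N h), ∑ j ∈ Finset.range (N (Δ₂ g i)),
        Θ (Δ₂ (Δ₂ g i) j * Δ₂ h m)
          (ρ (Sinv (Δ₁ (Δ₂ g i) j * Δ₁ h m)) (ρ (Δ₁ g i) a) * a0) := by
    intro i
    rw [sum_comul_mul hr (fun p q => Θ q (ρ (Sinv p) (ρ (Δ₁ g i) a) * a0)), Finset.sum_comm]
    · intro y
      exact ⟨by intros; simp [add_mul], by intros; simp⟩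
    · intro y
      exact ⟨by intros; simp, by intros; simp⟩
  rw [Finset.sum_congr rfl fun i _ => e1 i, Finset.sum_comm]
  refine Finset.sum_congr rfl fun m _ => ?_
  rw [← sum_coassoc hr (fun p q r => Θ (r * Δ₂ h m) (ρ (Sinv (q * Δ₁ h m)) (ρ p a) * a0))]
  · rw [← sum_eps_left hr (fun r => Θ (r * Δ₂ h m) (ρ (Sinv (Δ₁ h m)) a * a0))
      ⟨by intros; simp [add_mul], by intros; simp⟩ g]
    refine Finset.sum_congr rfl fun i _ => ?_
    have e2 := sum_Sinv_mul hr Sinv hSinv (Δ₁ g i)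
    have e3 := congrArg (fun y => Θ (Δ₂ g i * Δ₂ h m) (ρ (Sinv (Δ₁ h m)) (ρ y a) * a0)) e2
    simp only [map_sum, LinearMap.sum_apply, Finset.sum_mul, map_smul, LinearMap.smul_apply,
      smul_mul_assoc, hρ_one, LinearMap.id_apply] at e3
    rw [← e3]
    refine Finset.sum_congr rfl fun j _ => ?_
    simp only [Sinv_mul Sinv hSinv, hρ_mul, LinearMap.comp_apply]
  · intro q r
    exact ⟨by intros; simp [add_mul], by intros; simp⟩
  · intro q r
    exact ⟨by intros; simp [add_mul], by intros; simp⟩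
  · intro q r
    exact ⟨by intros; simp [add_mul], by intros; simp⟩

theorem act_key {N : H → ℕ} {Δ₁ Δ₂ : H → ℕ → H} (hr : HRep N Δ₁ Δ₂)
    (ρ : H →ₗ[ℂ] A →ₗ[ℂ] A) (hρ_one : ρ 1 = LinearMap.id)
    (hρ_mul : ∀ g h : H, ρ (g * h) = ρ g ∘ₗ ρ h)
    (hact_mul : ∀ (h : H) (a b : A),
      ρ h (a * b) = ∑ i ∈ Finset.range (N h), ρ (Δ₁ h i) a * ρ (Δ₂ h i) b)
    (Sinv : H →ₗ[ℂ] H)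
    (hSinv : ∀ h : H, Sinv (HopfAlgebra.antipode (R := ℂ) h) = h ∧
      HopfAlgebra.antipode (R := ℂ) (Sinv h) = h)
    (a a0 : A) (p : H) :
    ∑ i ∈ Finset.range (N p), ρ (Δ₂ p i) (ρ (Sinv (Δ₁ p i)) a * a0) = a * ρ p a0 := by
  simp only [hact_mul]
  rw [← sum_coassoc hr (fun x y z => ρ y (ρ (Sinv x) a) * ρ z a0)]
  · rw [← sum_eps_left hr (fun r => a * ρ r a0)
      ⟨by intros; simp [mul_add], by intros; simp⟩ p]
    refine Finset.sum_congr rfl fun i _ => ?_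
    have e2 := sum_mul_Sinv hr Sinv hSinv (Δ₁ p i)
    have e3 := congrArg (fun y => ρ y a * ρ (Δ₂ p i) a0) e2
    simp only [map_sum, LinearMap.sum_apply, Finset.sum_mul, map_smul, LinearMap.smul_apply,
      smul_mul_assoc, hρ_one, LinearMap.id_apply, hρ_mul, LinearMap.comp_apply] at e3
    exact e3
  · intro q r
    exact ⟨by intros; simp [add_mul], by intros; simp⟩
  · intro q r
    exact ⟨by intros; simp [add_mul], by intros; simp⟩
  · intro q r
    exact ⟨by intros; simp [mul_add], by intros; simp⟩

theorem act_key2 {N : H → ℕ} {Δ₁ Δ₂ : H → ℕ → H} (hr : HRep N Δ₁ Δ₂)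
    (ρ : H →ₗ[ℂ] A →ₗ[ℂ] A) (hρ_one : ρ 1 = LinearMap.id)
    (hρ_mul : ∀ g h : H, ρ (g * h) = ρ g ∘ₗ ρ h)
    (hact_mul : ∀ (h : H) (a b : A),
      ρ h (a * b) = ∑ i ∈ Finset.range (N h), ρ (Δ₁ h i) a * ρ (Δ₂ h i) b)
    (Sinv : H →ₗ[ℂ] H)
    (hSinv : ∀ h : H, Sinv (HopfAlgebra.antipode (R := ℂ) h) = h ∧
      HopfAlgebra.antipode (R := ℂ) (Sinv h) = h)
    (a a0 : A) (C : A → H → ℂ) (hC1 : ∀ q, IsLinearMap ℂ (fun b => C b q))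
    (hC2 : ∀ b, IsLinearMap ℂ (fun q => C b q)) (h : H) :
    ∑ m ∈ Finset.range (N h), C (a * ρ (Δ₁ h m) a0) (Δ₂ h m) =
    ∑ m ∈ Finset.range (N h), ∑ i ∈ Finset.range (N (Δ₂ h m)),
      C (ρ (Δ₁ (Δ₂ h m) i) (ρ (Sinv (Δ₁ h m)) a * a0)) (Δ₂ (Δ₂ h m) i) := by
  rw [← sum_coassoc hr (fun x y z => C (ρ y (ρ (Sinv x) a * a0)) z)]
  · refine Finset.sum_congr rfl fun m _ => ?_
    rw [← act_key hr ρ hρ_one hρ_mul hact_mul Sinv hSinv]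
    exact map_sum ((hC1 (Δ₂ h m)).mk' _) _ _
  · intro q r
    exact ⟨by intros; simp [add_mul, (hC1 _).map_add],
      by intros; simpa using (hC1 _).map_smul _ _⟩
  · intro q r
    exact ⟨by intros; simp [(hC1 _).map_add],
      by intros; simpa using (hC1 _).map_smul _ _⟩
  · intro q r
    exact hC2 _

theorem conj_key {N : H → ℕ} {Δ₁ Δ₂ : H → ℕ → H} (hr : HRep N Δ₁ Δ₂)
    (u : H →ₗ[ℂ] ℂ) (g p : H) :
    ∑ i ∈ Finset.range (N p), ∑ j ∈ Finset.range (N (Δ₁ p i)),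
      u (HopfAlgebra.antipode (R := ℂ) (Δ₂ (Δ₁ p i) j) * (Δ₂ p i * g) * Δ₁ (Δ₁ p i) j) =
    u (g * p) := by
  rw [sum_coassoc hr (fun x y z => u (HopfAlgebra.antipode (R := ℂ) y * (z * g) * x))]
  · rw [← sum_eps_right hr (fun r => u (g * r))
      ⟨by intros; simp [mul_add], by intros; simp⟩ p]
    refine Finset.sum_congr rfl fun i _ => ?_
    have e2 := HopfAlgebra.sum_antipode_mul_eq_smul (R := ℂ) (hr.repr (Δ₂ p i))
    have e3 := congrArg (fun y => u (y * g * Δ₁ p i)) e2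
    simp only [HRep.repr, map_sum, Finset.sum_mul, map_smul,
      smul_mul_assoc, one_mul] at e3
    rw [← e3]
    simp only [mul_assoc]
  · intro q r
    exact ⟨by intros; simp [mul_add], by intros; simp⟩
  · intro q r
    exact ⟨by intros; simp [add_mul], by intros; simp⟩
  · intro q r
    exact ⟨by intros; simp [mul_add, add_mul], by intros; simp⟩

theorem rhs_point {n : ℕ} {N : H → ℕ} {Δ₁ Δ₂ : H → ℕ → H} (hr : HRep N Δ₁ Δ₂)
    (ρ : H →ₗ[ℂ] A →ₗ[ℂ] A) (hρ_one : ρ 1 = LinearMap.id)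
    (hρ_mul : ∀ g h : H, ρ (g * h) = ρ g ∘ₗ ρ h)
    (hact_mul : ∀ (h : H) (a b : A),
      ρ h (a * b) = ∑ i ∈ Finset.range (N h), ρ (Δ₁ h i) a * ρ (Δ₂ h i) b)
    (Sinv : H →ₗ[ℂ] H)
    (hSinv : ∀ h : H, Sinv (HopfAlgebra.antipode (R := ℂ) h) = h ∧
      HopfAlgebra.antipode (R := ℂ) (Sinv h) = h)
    (φ : H →ₗ[ℂ] MultilinearMap ℂ (fun _ : Fin (n+1) => A) ℂ)
    (hφ : IsEquivariant N Δ₁ Δ₂ ρ (fun h a => φ h a))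
    (a a0 : A) (g h : H) (v : Fin n → A) :
    ∑ m ∈ Finset.range (N h), psiAux N Δ₁ Δ₂ ρ n (Δ₂ h m) (fun j => (v j, 1))
      (fun p w => φ (p * g) (Fin.cons (a * ρ (Δ₁ h m) a0) w)) =
    ∑ m ∈ Finset.range (N h),
      φ (g * Δ₂ h m) (Fin.cons (ρ (Sinv (Δ₁ h m)) a * a0) v) := by
  let φg : H →ₗ[ℂ] MultilinearMap ℂ (fun _ : Fin (n+1) => A) ℂ := φ ∘ₗ LinearMap.mulRight ℂ g
  rw [act_key2 hr ρ hρ_one hρ_mul hact_mul Sinv hSinv a a0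
    (fun b q => psiAux N Δ₁ Δ₂ ρ n q (fun j => (v j, 1))
      (fun p w => φ (p * g) (Fin.cons b w)))]
  · refine Finset.sum_congr rfl fun m _ => ?_
    set b : Fin (n+1) → A := Fin.cons (ρ (Sinv (Δ₁ h m)) a * a0) v with hb
    have e1 := psiAux_split hr ρ (n+1) b (Δ₂ h m) φg
    have e2 : ∀ i, psiAux N Δ₁ Δ₂ ρ (n+1) (Δ₁ (Δ₂ h m) i) (fun j => (b j, 1))
        (fun p v => Coalgebra.counit (R := ℂ) p * φg (Δ₂ (Δ₂ h m) i) v) =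
        ∑ j ∈ Finset.range (N (Δ₁ (Δ₂ h m) i)),
          φ (HopfAlgebra.antipode (R := ℂ) (Δ₂ (Δ₁ (Δ₂ h m) i) j) * (Δ₂ (Δ₂ h m) i * g)
            * Δ₁ (Δ₁ (Δ₂ h m) i) j) b := by
      intro i
      rw [← sweedler_eq_psiAux hr]
      exact (hφ (Δ₁ (Δ₂ h m) i) (Δ₂ (Δ₂ h m) i * g) b).symm
    rw [Finset.sum_congr rfl fun i _ => e2 i] at e1
    have hu : IsLinearMap ℂ (fun q => φ q b) := ⟨by intros; simp, by intros; simp⟩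
    have e3 := conj_key hr (hu.mk' _) g (Δ₂ h m)
    refine Eq.trans ?_ (e1.trans e3)
    rw [psiAux]
    simp only [mul_one]
    rfl
  · intro q
    exact psiAux_lin_F N Δ₁ Δ₂ ρ n _ _ _ (fun p w => cons_lin _ _)
  · intro b
    exact psiAux_lin_g hr ρ n _ (cur φg b)

/-- `Ψ` commutes with the last face map:
`Ψ(dⁿ⁺¹φ)(x⁰,…,xⁿ⁺¹) = Ψφ(xⁿ⁺¹x⁰, x¹, …, xⁿ)` on elementary tensors, where
`dⁿ⁺¹φ(h, a⁰,…,aⁿ⁺¹) = φ(h₍₂₎, S⁻¹(h₍₁₎)(aⁿ⁺¹)a⁰, a¹, …, aⁿ)`. -/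
theorem statement10 {n : ℕ}
    (N : H → ℕ) (Δ₁ Δ₂ : H → ℕ → H)
    (hrep : ∀ g : H, (Coalgebra.comul (R := ℂ) g : H ⊗[ℂ] H) =
      ∑ i ∈ Finset.range (N g), Δ₁ g i ⊗ₜ[ℂ] Δ₂ g i)
    (ρ : H →ₗ[ℂ] A →ₗ[ℂ] A)
    (hρ_one : ρ 1 = LinearMap.id)
    (hρ_mul : ∀ g h : H, ρ (g * h) = ρ g ∘ₗ ρ h)
    (hact_mul : ∀ (h : H) (a b : A),
      ρ h (a * b) = ∑ i ∈ Finset.range (N h), ρ (Δ₁ h i) a * ρ (Δ₂ h i) b)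
    (hact_one : ∀ h : H, ρ h 1 = (Coalgebra.counit (R := ℂ) h) • (1 : A))
    (Sinv : H →ₗ[ℂ] H)
    (hSinv : ∀ h : H, Sinv (HopfAlgebra.antipode (R := ℂ) h) = h ∧
      HopfAlgebra.antipode (R := ℂ) (Sinv h) = h)
    (φ : H →ₗ[ℂ] MultilinearMap ℂ (fun _ : Fin (n+1) => A) ℂ)
    (hφ : IsEquivariant N Δ₁ Δ₂ ρ (fun h a => φ h a)) :
    ∀ x : Fin (n+2) → A × H,
      psiV N Δ₁ Δ₂ ρ
        (fun h a => sweedler N Δ₁ Δ₂ 1 h (fun ℓ =>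
          φ (ℓ 1) (Fin.cons (ρ (Sinv (ℓ 0)) (a (Fin.last (n+1))) * a 0)
            (fun j : Fin n => a j.succ.castSucc)))) x
      = ∑ m ∈ Finset.range (N (x (Fin.last (n+1))).2),
          psiV N Δ₁ Δ₂ ρ (fun h a => φ h a)
            (Fin.cons (cpPairTerm Δ₁ Δ₂ ρ (x (Fin.last (n+1))) (x 0) m)
              (fun j : Fin n => x j.succ.castSucc)) := by
  intro x
  have hr : HRep N Δ₁ Δ₂ := hrep
  set h := (x (Fin.last (n+1))).2 with hh
  set a := (x (Fin.last (n+1))).1 with ha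
  have eL : psiV N Δ₁ Δ₂ ρ
        (fun h a => sweedler N Δ₁ Δ₂ 1 h (fun ℓ =>
          φ (ℓ 1) (Fin.cons (ρ (Sinv (ℓ 0)) (a (Fin.last (n+1))) * a 0)
            (fun j : Fin n => a j.succ.castSucc)))) x
      = psiAux N Δ₁ Δ₂ ρ n (x 0).2 (fun j => x j.succ.castSucc) (fun g v =>
          ∑ m ∈ Finset.range (N h),
            φ (g * Δ₂ h m) (Fin.cons (ρ (Sinv (Δ₁ h m)) a * (x 0).1) v)) := by
    rw [psiV, psiAux_last]
    congr 1
    funext g v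
    let Θ : H →ₗ[ℂ] A →ₗ[ℂ] ℂ := LinearMap.mk₂ ℂ (fun p b => φ p (Fin.cons b v))
      (by intros; simp) (by intros; simp)
      (fun p b c => (cons_lin (φ p) v).map_add b c) (fun c p b => (cons_lin (φ p) v).map_smul c b)
    refine Eq.trans ?_ (lhs_point hr ρ hρ_one hρ_mul Sinv hSinv Θ a (x 0).1 g h)
    refine Finset.sum_congr rfl fun i _ => ?_
    simp only [sweedler]
    refine Finset.sum_congr rfl fun j _ => ?_
    simp only [Θ, LinearMap.mk₂_apply]
    rw [← Fin.succ_last, Fin.cons_succ, Fin.snoc_last, Fin.cons_zero]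
    have : (fun j : Fin n => (Fin.cons (x 0).1 (Fin.snoc (α := fun _ => A) v
        (ρ (Δ₁ g i) (x (Fin.last n).succ).1)) : Fin (n+2) → A) j.succ.castSucc) = v := by
      funext j
      rw [← Fin.succ_castSucc, Fin.cons_succ, Fin.snoc_castSucc]
    rw [this]
    rfl
  rw [eL]
  have eR : ∀ m, psiV N Δ₁ Δ₂ ρ (fun h a => φ h a)
            (Fin.cons (cpPairTerm Δ₁ Δ₂ ρ (x (Fin.last (n+1))) (x 0) m)
              (fun j : Fin n => x j.succ.castSucc)) =
      psiAux N Δ₁ Δ₂ ρ n (x 0).2 (fun j => x j.succ.castSucc) (fun g v =>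
        psiAux N Δ₁ Δ₂ ρ n (Δ₂ h m) (fun j => (v j, 1))
          (fun p w => φ (p * g) (Fin.cons (a * ρ (Δ₁ h m) (x 0).1) w))) := by
    intro m
    exact psiAux_mul hr ρ hρ_mul n (fun j => x j.succ.castSucc) (x 0).2 (Δ₂ h m)
      (cur φ (a * ρ (Δ₁ h m) (x 0).1))
  rw [Finset.sum_congr rfl fun m _ => eR m, ← psiAux_sum]
  congr 1
  funext g v
  exact (rhs_point hr ρ hρ_one hρ_mul hact_mul Sinv hSinv φ hφ a (x 0).1 g h v).symm

end
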